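/- Let u, v be nonempty abelian equivalent words over {0,1,2} such that u·v is a factor of x = g^ω(0), and suppose λ_u = λ_v. Let u', v' be words over {0,1,2} such that u'·v' is a factor of x and either g(u') = u and g(v') = v, or g(v') = reverse(u) and g(u') = reverse(v). Then u' and v' are abelian equivalent and λ_{u'} = λ_{v'}. -/

import Mathlib

/-- Number of occurrences of `v` as a scattered subword (subsequence) of `u`. -/
def binomC {α : Type*} [DecidableEq α] (u v : List α) : ℕ := u.sublists.count v

/-- Two words are 2-binomially equivalent. -/
def binEq2 {α : Type*} [DecidableEq α] (u v : List α) : Prop :=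
  ∀ x : List α, x.length ≤ 2 → binomC u x = binomC v x

/-- The morphism g : 0 ↦ 012, 1 ↦ 02, 2 ↦ 1. -/
def g : Fin 3 → List (Fin 3) := ![[0,1,2],[0,2],[1]]

/-- Apply the morphism g to a word. -/
def gWord (w : List (Fin 3)) : List (Fin 3) := w.flatMap g

/-- The prefix g^n(0) of the ternary Thue–Morse word. -/
def gPow (n : ℕ) : List (Fin 3) := gWord^[n] [0]

/-- λ_u = C(u,01) − C(u,12). -/
def lam (u : List (Fin 3)) : ℤ := (binomC u [0,1] : ℤ) - (binomC u [1,2] : ℤ)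

theorem binomC_nil_right {α : Type*} [DecidableEq α] (w : List α) : binomC w [] = 1 := by
  unfold binomC
  rw [(List.sublists_perm_sublists' w).count_eq]
  induction w with
  | nil => simp
  | cons x w ih =>
    rw [List.sublists'_cons, List.count_append, ih, List.count_eq_zero_of_not_mem]
    simp

theorem binomC_nil_cons {α : Type*} [DecidableEq α] (p : α) (v : List α) :
    binomC [] (p :: v) = 0 := by
  simp [binomC]

theorem binomC_cons_cons {α : Type*} [DecidableEq α] (x p : α) (w v : List α) :
    binomC (x :: w) (p :: v) = binomC w (p :: v) + if x = p then binomC w v else 0 := by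
  unfold binomC
  simp only [(List.sublists_perm_sublists' _).count_eq, List.sublists'_cons, List.count_append]
  congr 1
  split_ifs with h
  · subst h
    exact List.count_map_of_injective _ _ List.cons_injective _
  · refine List.count_eq_zero_of_not_mem ?_
    simp [h]

theorem binomC_singleton {α : Type*} [DecidableEq α] (w : List α) (p : α) :
    binomC w [p] = w.count p := by
  induction w with
  | nil => simp [binomC_nil_cons]
  | cons x w ih => simp [binomC_cons_cons, binomC_nil_right, ih, List.count_cons]

theorem binomC_reverse {α : Type*} [DecidableEq α] (w v : List α) :
    binomC w.reverse v.reverse = binomC w v := by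
  unfold binomC
  rw [List.sublists_reverse, List.count_map_of_injective _ _ List.reverse_injective,
    (List.sublists_perm_sublists' w).count_eq]

theorem binomC_pair_add_swap {α : Type*} [DecidableEq α] {p q : α} (h : p ≠ q) (w : List α) :
    binomC w [p, q] + binomC w [q, p] = w.count p * w.count q := by
  induction w with
  | nil => simp [binomC_nil_cons]
  | cons x w ih =>
    simp only [binomC_cons_cons, binomC_singleton, List.count_cons, beq_iff_eq]
    by_cases h1 : x = p
    · subst h1
      simp only [h, if_true, if_false]
      linarith
    · by_cases h2 : x = q
      · subst h2
        simp only [h1, if_true, if_false]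
        linarith
      · simp only [h1, h2, if_false]
        linarith

theorem lam_reverse (w : List (Fin 3)) :
    lam w.reverse = -lam w + w.count 1 * ((w.count 0 : ℤ) - w.count 2) := by
  have h01 := binomC_pair_add_swap (show (0 : Fin 3) ≠ 1 by decide) w
  have h12 := binomC_pair_add_swap (show (1 : Fin 3) ≠ 2 by decide) w
  have r01 : binomC w.reverse [0, 1] = binomC w [1, 0] := binomC_reverse w [1, 0]
  have r12 : binomC w.reverse [1, 2] = binomC w [2, 1] := binomC_reverse w [2, 1]
  unfold lam
  rw [r01, r12]
  zify at h01 h12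
  linarith

theorem gWord_cons (x : Fin 3) (w : List (Fin 3)) : gWord (x :: w) = g x ++ gWord w := rfl

theorem count_gWord (w : List (Fin 3)) :
    (gWord w).count 0 = w.count 0 + w.count 1 ∧ (gWord w).count 1 = w.count 0 + w.count 2 ∧
      (gWord w).count 2 = w.count 0 + w.count 1 := by
  induction w with
  | nil => simp [gWord]
  | cons x w ih =>
    obtain ⟨h0, h1, h2⟩ := ih
    rw [gWord_cons]
    fin_cases x <;> simp [g, h0, h1, h2] <;> omega

theorem lam_gWord (w : List (Fin 3)) :
    lam (gWord w) = -2 * lam w + ((binomC w [0, 2] : ℤ) - binomC w [2, 0])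
      + w.count 1 * ((w.count 0 : ℤ) - w.count 2) := by
  induction w with
  | nil => simp [gWord, lam, binomC_nil_cons]
  | cons x w ih =>
    obtain ⟨-, h1, h2⟩ := count_gWord w
    unfold lam at ih ⊢
    rw [gWord_cons]
    fin_cases x <;>
      simp [g, binomC_cons_cons, binomC_singleton, h1, h2] <;> linarith

/-- Starting from the value `s`, adding `1` for each letter `0` and subtracting `1` for each
letter `2` keeps the running total in `{0, 1}`: the letters `0` and `2` alternate. -/
def Alternates : ℤ → List (Fin 3) → Prop
  | s, [] => s = 0 ∨ s = 1
  | s, x :: w => (s = 0 ∨ s = 1) ∧ Alternates (s + (![1, 0, -1] : Fin 3 → ℤ) x) w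

theorem Alternates.start {s : ℤ} {w : List (Fin 3)} (h : Alternates s w) : s = 0 ∨ s = 1 := by
  cases w with
  | nil => exact h
  | cons x w => exact h.1

theorem Alternates.of_append {s : ℤ} {p w : List (Fin 3)} (h : Alternates s (p ++ w)) :
    Alternates s p ∧ Alternates (s + p.count 0 - p.count 2) w := by
  induction p generalizing s with
  | nil => exact ⟨h.start, by simpa using h⟩
  | cons x p ih =>
    obtain ⟨hs, h⟩ := h
    obtain ⟨h1, h2⟩ := ih h
    refine ⟨⟨hs, h1⟩, ?_⟩
    convert h2 using 1
    fin_cases x <;> simp <;> ring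

theorem Alternates.finish {s : ℤ} {w : List (Fin 3)} (h : Alternates s w) :
    s + w.count 0 - w.count 2 = 0 ∨ s + w.count 0 - w.count 2 = 1 := by
  have h' : Alternates s (w ++ []) := by simpa using h
  exact h'.of_append.2

theorem alternates_gWord (w : List (Fin 3)) : Alternates 0 (gWord w) := by
  induction w with
  | nil => exact Or.inl rfl
  | cons x w ih =>
    rw [gWord_cons]
    fin_cases x <;> simpa [g, Alternates] using ih

theorem alternates_gPow (n : ℕ) : Alternates 0 (gPow n) := by
  cases n with
  | zero => simp [gPow, Alternates]
  | succ n =>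
    rw [gPow, Function.iterate_succ_apply']
    exact alternates_gWord _

theorem Alternates.binomC_sub {s : ℤ} {w : List (Fin 3)} (h : Alternates s w) :
    (binomC w [0, 2] : ℤ) - binomC w [2, 0] =
      (1 - 2 * s - w.count 0 + w.count 2) * w.count 0 := by
  induction w generalizing s with
  | nil => simp [binomC_nil_cons]
  | cons x w ih =>
    obtain ⟨hs, h⟩ := h
    have e := ih h
    have hst := h.start
    have hf := h.finish
    fin_cases x <;>
      simp [binomC_cons_cons, binomC_singleton] at e hst hf ⊢
    · obtain rfl : s = 0 := by omega
      linarith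
    · linarith
    · obtain rfl : s = 1 := by omega
      linarith

theorem count_eq_and_lam_eq_of_gWord {s : ℤ} {u v : List (Fin 3)} (h : Alternates s (u ++ v))
    (hab : ∀ a, (gWord u).count a = (gWord v).count a) (hlam : lam (gWord u) = lam (gWord v)) :
    (∀ a, u.count a = v.count a) ∧ lam u = lam v := by
  obtain ⟨hu, hv⟩ := h.of_append
  have h0 := hab 0
  have h1 := hab 1
  rw [(count_gWord u).1, (count_gWord v).1] at h0
  rw [(count_gWord u).2.1, (count_gWord v).2.1] at h1
  rw [lam_gWord, lam_gWord, hu.binomC_sub, hv.binomC_sub] at hlam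
  have hs := hu.start
  have hm := hu.finish
  have hf := hv.finish
  rw [Fin.forall_fin_succ, Fin.forall_fin_two]
  change (u.count 0 = v.count 0 ∧ u.count 1 = v.count 1 ∧ u.count 2 = v.count 2) ∧ _
  generalize lam u = l at *
  generalize lam v = l' at *
  generalize u.count 0 = a at *
  generalize u.count 1 = b at *
  generalize u.count 2 = c at *
  generalize v.count 0 = a' at *
  generalize v.count 1 = b' at *
  generalize v.count 2 = c' at *
  generalize hm' : s + (a : ℤ) - c = m at *
  generalize hf' : m + (a' : ℤ) - c' = f at *
  have e1 : (a : ℤ) - c = m - s := by linarith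
  have e2 : (a' : ℤ) - c' = f - m := by linarith
  have e3 : 1 - 2 * s - (a : ℤ) + c = 1 - s - m := by linarith
  have e4 : 1 - 2 * m - (a' : ℤ) + c' = 1 - m - f := by linarith
  rw [e1, e2, e3, e4] at hlam
  rcases hs with rfl | rfl <;> rcases hm with rfl | rfl <;> rcases hf with rfl | rfl <;>
    norm_num at hlam <;> omega

/-- Desubstitution preserves abelian equivalence and the λ-invariant. -/
theorem desubstitution_preserves_lambda
    (u v : List (Fin 3)) (hu : u ≠ []) (hv : v ≠ [])
    (hab : ∀ a : Fin 3, u.count a = v.count a)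
    (hfac : ∃ n : ℕ, (u ++ v) <:+: gPow n)
    (hlam : lam u = lam v)
    (u' v' : List (Fin 3))
    (hfac' : ∃ m : ℕ, (u' ++ v') <:+: gPow m)
    (hdesub : (gWord u' = u ∧ gWord v' = v) ∨
              (gWord v' = u.reverse ∧ gWord u' = v.reverse)) :
    (∀ a : Fin 3, u'.count a = v'.count a) ∧ lam u' = lam v' := by
  obtain ⟨m, p, q, hpq⟩ := hfac'
  have h := alternates_gPow m
  rw [← hpq] at h
  have halt := h.of_append.1.of_append.2
  rcases hdesub with ⟨rfl, rfl⟩ | ⟨h1, h2⟩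
  · exact count_eq_and_lam_eq_of_gWord halt hab hlam
  · refine count_eq_and_lam_eq_of_gWord halt (fun a => ?_) ?_
    · rw [h1, h2, List.count_reverse, List.count_reverse, hab]
    · rw [h1, h2, lam_reverse, lam_reverse, hlam, hab 0, hab 1, hab 2]
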